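/- For every p ∈ (0,1), every γ < 0 and every r ∈ (1/2, 1), there exists a unique κ ∈ (0, 1/2) such that Φ(−κ) = −2(1−p)·(1 − exp(γ))·√(2/π)·(2r − 1)/√(r(1−r)). (This unique solution is denoted κ*_{γ,r}(p).) -/

import Mathlib

open MeasureTheory Real

/-- The density of the Lévy measure `Λ` of the subordinator in the Lamperti
representation of the tagged fragment of the Brownian excursion fragmentation:
`ρ(x) = 2·exp(x)/√(2π·(exp(x) − 1)³)`. -/
noncomputable def levyDensity (x : ℝ) : ℝ :=
  2 * Real.exp x / Real.sqrt (2 * Real.pi * (Real.exp x - 1) ^ 3)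

/-- The Laplace exponent `Φ(q) = ∫₀^∞ (1 − exp(−q·x))·ρ(x) dx`. -/
noncomputable def Phi (q : ℝ) : ℝ :=
  ∫ x in Set.Ioi (0:ℝ), (1 - Real.exp (-q * x)) * levyDensity x

lemma levyDensity_nonneg (x : ℝ) : 0 ≤ levyDensity x := by
  unfold levyDensity; positivity

lemma measurable_levyDensity : Measurable levyDensity := by
  unfold levyDensity; fun_prop

/-- Comparison of the Lévy density with an exponential, from below. -/
lemma exp_neg_half_le_levyDensity {x : ℝ} (hx : 0 < x) :
    2 / √(2 * π) * exp (-(1 / 2) * x) ≤ levyDensity x := by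
  have h1 : 0 < exp x - 1 := by linarith [add_one_le_exp x]
  have h2 : √(2 * π * (exp x - 1) ^ 3) ≤ √(2 * π) * exp (3 / 2 * x) := by
    rw [sqrt_mul (by positivity)]
    gcongr
    apply sqrt_le_iff.2 ⟨(exp_pos _).le, ?_⟩
    calc (exp x - 1) ^ 3 ≤ exp x ^ 3 := by gcongr; linarith
      _ = exp (3 / 2 * x) ^ 2 := by
        rw [← exp_nat_mul, ← exp_nat_mul]; congr 1; push_cast; ring
  unfold levyDensity
  calc 2 / √(2 * π) * exp (-(1 / 2) * x)
      = 2 * exp x / (√(2 * π) * exp (3 / 2 * x)) := by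
        have : exp x = exp (-(1 / 2) * x) * exp (3 / 2 * x) := by
          rw [← exp_add]; congr 1; ring
        rw [this]; field_simp
    _ ≤ _ := by gcongr

/-- Bound of the Lévy density from above, sharp in order at zero. -/
lemma levyDensity_le {x : ℝ} (hx : 0 < x) :
    levyDensity x ≤ 2 * (1 + x) ^ 2 / (x * √x) * exp (-(1 / 2) * x) := by
  have h0 : exp x * x / (1 + x) ≤ exp x - 1 := by
    rw [div_le_iff₀ (by positivity)]; nlinarith [add_one_le_exp x]
  have h2 : exp (3 / 2 * x) * (x * √x) / (1 + x) ^ 2 ≤ √(2 * π * (exp x - 1) ^ 3) := by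
    apply le_sqrt_of_sq_le
    have e1 : exp (3 / 2 * x) ^ 2 = exp x ^ 3 := by
      rw [← exp_nat_mul, ← exp_nat_mul]; congr 1; push_cast; ring
    calc (exp (3 / 2 * x) * (x * √x) / (1 + x) ^ 2) ^ 2
        = (exp x * x / (1 + x)) ^ 3 / (1 + x) := by
          rw [div_pow, mul_pow, mul_pow, e1, sq_sqrt hx.le]; field_simp
      _ ≤ (exp x * x / (1 + x)) ^ 3 := div_le_self (by positivity) (by linarith)
      _ ≤ (exp x - 1) ^ 3 := by gcongr
      _ ≤ 2 * π * (exp x - 1) ^ 3 := by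
          have : 0 ≤ (exp x - 1) ^ 3 := pow_nonneg (le_trans (by positivity) h0) 3
          nlinarith [pi_gt_three]
  unfold levyDensity
  calc _ ≤ 2 * exp x / (exp (3 / 2 * x) * (x * √x) / (1 + x) ^ 2) := by gcongr
    _ = _ := by
        have : exp x = exp (-(1 / 2) * x) * exp (3 / 2 * x) := by
          rw [← exp_add]; congr 1; ring
        rw [this]; field_simp

lemma integrableOn_exp_sub_one_mul_levyDensity {κ : ℝ} (h0 : 0 ≤ κ) (h1 : κ < 1 / 2) :
    IntegrableOn (fun x => (exp (κ * x) - 1) * levyDensity x) (Set.Ioi 0) := by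
  have hb : 0 < 1 / 2 - κ := by linarith
  have hint (s : ℝ) (hs : -1 < s) :
      IntegrableOn (fun x : ℝ => x ^ s * exp (-(1 / 2 - κ) * x)) (Set.Ioi 0) := by
    simpa using integrableOn_rpow_mul_exp_neg_mul_rpow hs one_pos hb
  have hdom := (((hint (-1 / 2) (by norm_num)).add ((hint (1 / 2) (by norm_num)).const_mul 2)).add
    (hint (3 / 2) (by norm_num))).const_mul (2 * κ)
  refine Integrable.mono' hdom
    (Measurable.aestronglyMeasurable (by have := measurable_levyDensity; fun_prop)) ?_
  filter_upwards [ae_restrict_mem measurableSet_Ioi] with x hx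
  have hx : 0 < x := hx
  have hκx : 0 ≤ κ * x := by positivity
  have hexp : 0 ≤ exp (κ * x) - 1 := by linarith [add_one_le_exp (κ * x)]
  have hexp' : exp (κ * x) - 1 ≤ κ * x * exp (κ * x) := by
    have h : exp (-(κ * x)) * exp (κ * x) = 1 := by rw [← exp_add]; simp
    nlinarith [add_one_le_exp (-(κ * x)), exp_pos (κ * x)]
  rw [norm_of_nonneg (mul_nonneg hexp (levyDensity_nonneg x))]
  have hs := sqrt_pos.2 hx
  have r1 : x ^ (-1 / 2 : ℝ) = 1 / √x := by
    rw [sqrt_eq_rpow, neg_div, rpow_neg hx.le, one_div (x ^ _)]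
  have r2 : x ^ (1 / 2 : ℝ) = x / √x := by
    rw [← sqrt_eq_rpow, div_sqrt]
  have r3 : x ^ (3 / 2 : ℝ) = x ^ 2 / √x := by
    rw [show (3 / 2 : ℝ) = 1 + 1 / 2 by norm_num, rpow_add hx, rpow_one, r2]; ring
  calc (exp (κ * x) - 1) * levyDensity x
      ≤ (κ * x * exp (κ * x)) * (2 * (1 + x) ^ 2 / (x * √x) * exp (-(1 / 2) * x)) :=
        mul_le_mul hexp' (levyDensity_le hx) (levyDensity_nonneg x) (by positivity)
    _ = _ := by
        have : exp (-(1 / 2 - κ) * x) = exp (κ * x) * exp (-(1 / 2) * x) := by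
          rw [← exp_add]; congr 1; ring
        simp only [Pi.add_apply, r1, r2, r3, this]
        field_simp
        ring

lemma neg_Phi_neg (κ : ℝ) :
    -Phi (-κ) = ∫ x in Set.Ioi (0 : ℝ), (exp (κ * x) - 1) * levyDensity x := by
  rw [Phi, ← integral_neg]
  congr 1; ext x; rw [neg_neg]; ring

lemma convexOn_neg_Phi_neg : ConvexOn ℝ (Set.Ico 0 (1 / 2)) fun κ => -Phi (-κ) := by
  refine ⟨convex_Ico _ _, fun a ha b hb s t hs ht hst => ?_⟩
  have hc := convex_Ico (0 : ℝ) (1 / 2) ha hb hs ht hst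
  have ia := integrableOn_exp_sub_one_mul_levyDensity ha.1 ha.2
  have ib := integrableOn_exp_sub_one_mul_levyDensity hb.1 hb.2
  simp only [neg_Phi_neg, smul_eq_mul] at hc ⊢
  rw [← integral_const_mul, ← integral_const_mul,
    ← integral_add (ia.const_mul s) (ib.const_mul t)]
  refine integral_mono (integrableOn_exp_sub_one_mul_levyDensity hc.1 hc.2)
    ((ia.const_mul s).add (ib.const_mul t)) fun x => ?_
  have h := convexOn_exp.2 (Set.mem_univ (a * x)) (Set.mem_univ (b * x)) hs ht hst
  simp only [smul_eq_mul] at h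
  rw [show s * (a * x) + t * (b * x) = (s * a + t * b) * x by ring] at h
  calc (exp ((s * a + t * b) * x) - 1) * levyDensity x
      ≤ (s * exp (a * x) + t * exp (b * x) - (s + t)) * levyDensity x := by
        rw [hst]; gcongr; exact levyDensity_nonneg x
    _ = _ := by ring

lemma le_neg_Phi_neg {κ : ℝ} (h0 : 0 ≤ κ) (h1 : κ < 1 / 2) :
    2 / √(2 * π) * (1 / (1 / 2 - κ) - 2) ≤ -Phi (-κ) := by
  have hb : κ - 1 / 2 < 0 := by linarith
  have hc : (-(1 / 2) : ℝ) < 0 := by norm_num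
  have i1 := integrableOn_exp_mul_Ioi hb 0
  have i2 := integrableOn_exp_mul_Ioi hc 0
  have e1 := integral_exp_mul_Ioi hb 0
  have e2 := integral_exp_mul_Ioi hc 0
  have key : 2 / √(2 * π) * (1 / (1 / 2 - κ) - 2) = ∫ x in Set.Ioi (0 : ℝ),
      2 / √(2 * π) * (exp ((κ - 1 / 2) * x) - exp (-(1 / 2) * x)) := by
    rw [integral_const_mul, integral_sub i1 i2, e1, e2]
    have : 1 / 2 - κ ≠ 0 := by linarith
    rw [show κ - 1 / 2 = -(1 / 2 - κ) by ring, mul_zero, mul_zero, exp_zero, neg_div_neg_eq]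
    norm_num
  rw [key, neg_Phi_neg]
  refine setIntegral_mono_on ((i1.sub i2).const_mul _)
    (integrableOn_exp_sub_one_mul_levyDensity h0 h1) measurableSet_Ioi fun x hx => ?_
  have hx : 0 < x := hx
  have hexp : 0 ≤ exp (κ * x) - 1 := by
    linarith [add_one_le_exp (κ * x), mul_nonneg h0 hx.le]
  calc 2 / √(2 * π) * (exp ((κ - 1 / 2) * x) - exp (-(1 / 2) * x))
      = (exp (κ * x) - 1) * (2 / √(2 * π) * exp (-(1 / 2) * x)) := by
        rw [show (κ - 1 / 2) * x = κ * x + -(1 / 2) * x by ring, exp_add]; ring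
    _ ≤ _ := by gcongr; exact exp_neg_half_le_levyDensity hx

lemma Phi_zero : Phi 0 = 0 := by simp [Phi]

/-- Convexity of `κ ↦ -Φ(-κ)` and its vanishing at zero. -/
lemma mul_neg_Phi_neg_le {a b : ℝ} (ha : 0 ≤ a) (hab : a < b) (hb : b < 1 / 2) :
    b * -Phi (-a) ≤ a * -Phi (-b) := by
  have hb0 : 0 < b := ha.trans_lt hab
  have h0 : (0 : ℝ) ∈ Set.Ico (0 : ℝ) (1 / 2) := ⟨le_rfl, by norm_num⟩
  have hb' : b ∈ Set.Ico (0 : ℝ) (1 / 2) := ⟨hb0.le, hb⟩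
  have hs : 0 ≤ 1 - a / b := by rw [sub_nonneg, div_le_one hb0]; exact hab.le
  have ht : 0 ≤ a / b := by positivity
  have h := convexOn_neg_Phi_neg.2 h0 hb' hs ht (sub_add_cancel 1 (a / b))
  simp only [smul_eq_mul, neg_zero, Phi_zero, mul_zero, zero_add, div_mul_cancel₀ a hb0.ne'] at h
  calc b * -Phi (-a) ≤ b * (a / b * -Phi (-b)) := by gcongr
    _ = _ := by field_simp

/-- The function `κ ↦ -Φ(-κ)` takes every positive value exactly once on `(0, 1/2)`. -/
lemma existsUnique_neg_Phi_neg_eq {C : ℝ} (hC : 0 < C) :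
    ∃! κ : ℝ, κ ∈ Set.Ioo (0 : ℝ) (1 / 2) ∧ -Phi (-κ) = C := by
  have huniq {a b : ℝ} (ha : 0 < a) (hab : a < b) (hb : b < 1 / 2)
      (hCa : -Phi (-a) = C) (hCb : -Phi (-b) = C) : False := by
    have h := mul_neg_Phi_neg_le ha.le hab hb
    rw [hCa, hCb] at h
    nlinarith
  refine existsUnique_of_exists_of_unique ?_ ?_
  · have hc : 0 < 2 / √(2 * π) := by positivity
    set c := 2 / √(2 * π) with hcdef
    have hD : 0 < C / c := by positivity
    obtain ⟨b, hb0, hb1, hbC⟩ : ∃ b : ℝ, 0 < b ∧ b < 1 / 2 ∧ C ≤ -Phi (-b) := by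
      have hlt : 1 / (C / c + 2) < 1 / 2 := one_div_lt_one_div_of_lt (by norm_num) (by linarith)
      have hpos : 0 < 1 / (C / c + 2) := by positivity
      refine ⟨1 / 2 - 1 / (C / c + 2), by linarith, by linarith, ?_⟩
      have h := le_neg_Phi_neg (κ := 1 / 2 - 1 / (C / c + 2)) (by linarith) (by linarith)
      rw [← hcdef, sub_sub_cancel, one_div_one_div, add_sub_cancel_right,
        mul_div_cancel₀ C hc.ne'] at h
      exact h
    have hG : 0 < -Phi (-b) := hC.trans_le hbC
    set a := b * C / (2 * -Phi (-b)) with ha_def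
    have ha0 : 0 < a := by positivity
    have hab : a < b := by
      rw [ha_def, div_lt_iff₀ (by positivity)]; nlinarith
    have haC : -Phi (-a) ≤ C := by
      have h := mul_neg_Phi_neg_le ha0.le hab hb1
      have : a * -Phi (-b) = b * (C / 2) := by rw [ha_def]; field_simp [hG.ne', neg_ne_zero.1 hG.ne']
      rw [this] at h
      linarith [le_of_mul_le_mul_left h hb0]
    have hcont : ContinuousOn (fun κ => -Phi (-κ)) (Set.Icc a b) := by
      have h := convexOn_neg_Phi_neg.continuousOn_interior
      rw [interior_Ico] at h
      exact h.mono fun y hy => ⟨ha0.trans_le hy.1, hy.2.trans_lt hb1⟩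
    obtain ⟨κ, hκ, hκC⟩ := intermediate_value_Icc hab.le hcont ⟨haC, hbC⟩
    exact ⟨κ, ⟨ha0.trans_le hκ.1, hκ.2.trans_lt hb1⟩, hκC⟩
  · rintro a b ⟨ha, hCa⟩ ⟨hb, hCb⟩
    rcases lt_trichotomy a b with h | h | h
    · exact (huniq ha.1 h hb.2 hCa hCb).elim
    · exact h
    · exact (huniq hb.1 h ha.2 hCb hCa).elim

theorem stmt_11 (p γ r : ℝ) (hp : p ∈ Set.Ioo (0:ℝ) 1) (hγ : γ < 0)
    (hr : r ∈ Set.Ioo (1/2 : ℝ) 1) :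
    ∃! κ : ℝ, κ ∈ Set.Ioo (0:ℝ) (1/2) ∧
      Phi (-κ) = -(2 * (1 - p) * (1 - Real.exp γ) * Real.sqrt (2 / Real.pi) *
        (2 * r - 1) / Real.sqrt (r * (1 - r))) := by
  have h1 : 0 < 1 - p := by linarith [hp.2]
  have h2 : 0 < 1 - exp γ := by linarith [exp_lt_one_iff.2 hγ]
  have h3 : 0 < 2 * r - 1 := by linarith [hr.1]
  have h4 : 0 < r * (1 - r) := mul_pos (by linarith [hr.1]) (by linarith [hr.2])
  have hC : 0 < 2 * (1 - p) * (1 - exp γ) * √(2 / π) * (2 * r - 1) / √(r * (1 - r)) := by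
    positivity
  simpa only [neg_eq_iff_eq_neg] using existsUnique_neg_Phi_neg_eq hC
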